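/- Let D = {x ∈ {0,1}^ω : for every n with σ_n ∈ T_{μ_x}, r_n(x) ∉ {1/3, 2/3}}. Then λ₂(D) = 1, for every x ∈ D the tree T_{μ_x} has no dead ends, and the map Θ : D → {0,1,2}^ω sending x to the code of T_{μ_x} (where the i-th digit of the code is 0 if only the left child of the (i+1)-st length-lexicographic element σ of T_{μ_x} lies in T_{μ_x}, 1 if only the right child does, and 2 if both do) pushes λ₂ forward to the uniform product measure λ₃ on {0,1,2}^ω. -/

import Mathlib

open MeasureTheory
open scoped ENNReal

/-- Value of a binary string read as a binary numeral (most significant bit first). -/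
def strVal (σ : List Bool) : ℕ := σ.foldl (fun n b => 2 * n + b.toNat) 0

/-- Index of a binary string in the length-lexicographic enumeration of `{0,1}^{<ω}`,
so that `strIdx (strAt n) = n`. -/
def strIdx (σ : List Bool) : ℕ := 2 ^ σ.length + strVal σ - 1

/-- The `n`-th binary string `σ_n` in the length-lexicographic enumeration
(`strAt 0` is the empty string). -/
def strAt : ℕ → List Bool
  | 0 => []
  | n + 1 => strAt (n / 2) ++ [decide (n % 2 = 1)]
decreasing_by omega

/-- The initial segment `z↾n` of an infinite binary sequence, as a list. -/
def initSeg (z : ℕ → Bool) (n : ℕ) : List Bool := (List.range n).map z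

/-- The basic cylinder `[σ]` of all infinite binary sequences extending `σ`. -/
def cyl (σ : List Bool) : Set (ℕ → Bool) := {z | initSeg z σ.length = σ}

/-- The `1/3`-tree of a Borel measure `μ` on `{0,1}^ω`:
`T_μ = {σ : μ[σ↾(i+1)] > (1/3)·μ[σ↾i] for all i < |σ|}`. -/
def Tmeas (μ : Measure (ℕ → Bool)) : Set (List Bool) :=
  {σ | ∀ i < σ.length, (1 / 3 : ℝ≥0∞) * μ (cyl (σ.take i)) < μ (cyl (σ.take (i + 1)))}

/-- `r_n(x) = Σ_k x_n(k)·2^{-(k+1)}`: the real number in `[0,1]` whose binary expansion is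
the `n`-th column of `x` (with respect to the pairing `Nat.pair`). -/
noncomputable def rval (n : ℕ) (x : ℕ → Bool) : ℝ :=
  ∑' k, ((x (Nat.pair n k)).toNat : ℝ) * (1 / 2) ^ (k + 1)

/-- The code in `{0,1,2}^ω` of the tree `T_{μ_x}`: its `i`-th digit is `0` if only the left
child of the `(i+1)`-st length-lexicographic element `σ` of `T_{μ_x}` lies in `T_{μ_x}`,
`1` if only the right child does, and `2` if both do.  (Junk values where this does not
apply.) -/
noncomputable def theta (μ : (ℕ → Bool) → Measure (ℕ → Bool)) (x : ℕ → Bool) (i : ℕ) :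
    Fin 3 :=
  letI := Classical.propDecidable
  if h : ∃ σ : List Bool, σ ∈ Tmeas (μ x) ∧
      {τ : List Bool | τ ∈ Tmeas (μ x) ∧ strIdx τ < strIdx σ}.ncard = i then
    if Classical.choose h ++ [false] ∈ Tmeas (μ x) ∧
        Classical.choose h ++ [true] ∉ Tmeas (μ x) then 0
    else if Classical.choose h ++ [true] ∈ Tmeas (μ x) ∧
        Classical.choose h ++ [false] ∉ Tmeas (μ x) then 1
    else if Classical.choose h ++ [false] ∈ Tmeas (μ x) ∧
        Classical.choose h ++ [true] ∈ Tmeas (μ x) then 2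
    else 0
  else 0

theorem ext_of_prefix {α : Type*} [Countable α] [MeasurableSpace α] [MeasurableSingletonClass α]
    {P Q : Measure (ℕ → α)} [IsProbabilityMeasure P] [IsProbabilityMeasure Q]
    (h : ∀ (n : ℕ) (w : ℕ → α), P {y | ∀ i < n, y i = w i} = Q {y | ∀ i < n, y i = w i}) :
    P = Q := by
  refine IsProjectiveLimit.unique (P := fun I => P.map I.restrict) (fun I => rfl) fun I => ?_
  obtain ⟨n, hn⟩ : ∃ n, I ⊆ Finset.range n :=
    ⟨I.sup id + 1, fun i hi => Finset.mem_range.2 (Nat.lt_succ_of_le (Finset.le_sup (f := id) hi))⟩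
  have key : Q.map (Finset.range n).restrict = P.map (Finset.range n).restrict := by
    refine Measure.ext_iff_singleton.2 fun v => ?_
    rw [Measure.map_apply (by fun_prop) (measurableSet_singleton _),
      Measure.map_apply (by fun_prop) (measurableSet_singleton _)]
    rcases isEmpty_or_nonempty (ℕ → α) with hα | ⟨⟨w₀⟩⟩
    · rw [Subsingleton.elim P Q]
    · have : (Finset.range n).restrict (π := fun _ => α) ⁻¹' {v} =
          {y : ℕ → α | ∀ i < n, y i = if hi : i ∈ Finset.range n then v ⟨i, hi⟩ else w₀ i} := by
        ext y
        simp only [Set.mem_preimage, Set.mem_singleton_iff, funext_iff, Set.mem_ofPred_eq,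
          Subtype.forall, Finset.restrict]
        exact forall_congr' fun i => ⟨fun H hi => by simp [hi, H], fun H hi => by
          have := H (Finset.mem_range.1 hi); rw [this, dif_pos hi]⟩
      rw [this, h]
  have e : I.restrict = Finset.restrict₂ hn ∘ (Finset.range n).restrict (π := fun _ => α) := rfl
  show Q.map _ = P.map _
  rw [e, ← Measure.map_map (by fun_prop) (by fun_prop), key,
    Measure.map_map (by fun_prop) (by fun_prop)]

theorem infinitePi_prefix {α : Type*} [MeasurableSpace α] [MeasurableSingletonClass α]
    (ν : Measure α) [IsProbabilityMeasure ν] {c : ℝ≥0∞} (hν : ∀ a, ν {a} = c)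
    (n : ℕ) (w : ℕ → α) :
    Measure.infinitePi (fun _ : ℕ => ν) {y | ∀ i < n, y i = w i} = c ^ n := by
  have : {y : ℕ → α | ∀ i < n, y i = w i} = Set.pi (Finset.range n) fun i => {w i} := by
    ext; simp
  rw [this, Measure.infinitePi_pi _ fun i _ => measurableSet_singleton _]
  simp [hν]

theorem measurableSet_of_prefix {α : Type*} [Countable α] [MeasurableSpace α]
    [MeasurableSingletonClass α] {m : ℕ} {A : Set (ℕ → α)}
    (hA : ∀ y y' : ℕ → α, (∀ i < m, y i = y' i) → y ∈ A → y' ∈ A) : MeasurableSet A := by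
  let f : (ℕ → α) → (Fin m → α) := fun y i => y i
  have hf : Measurable f := by fun_prop
  have : A = f ⁻¹' (f '' A) := by
    refine (Set.subset_preimage_image f A).antisymm ?_
    rintro y ⟨y', hy', e⟩
    exact hA y' y (fun i hi => congrFun e ⟨i, hi⟩) hy'
  rw [this]
  exact hf (Set.to_countable _).measurableSet

theorem measure_prefix_inter {α : Type*} [Fintype α] [MeasurableSpace α]
    [MeasurableSingletonClass α] {P : Measure (ℕ → α)} {c : ℝ≥0∞}
    (hP : ∀ (n : ℕ) (w : ℕ → α), P {y | ∀ i < n, y i = w i} = c ^ n)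
    {m : ℕ} {A : Set (ℕ → α)}
    (hA : ∀ y y' : ℕ → α, (∀ i < m, y i = y' i) → y ∈ A → y' ∈ A) (a : α) :
    P (A ∩ {y | y m = a}) = c * P A := by
  let f : (ℕ → α) → (Fin m → α) := fun y i => y i
  have hf : Measurable f := by fun_prop
  have hsum (B : Set (ℕ → α)) : P B = ∑ v : Fin m → α, P (f ⁻¹' {v} ∩ B) := by
    have := sum_measure_preimage_singleton (μ := P.restrict B) (f := f) Finset.univ
      fun v _ => hf (measurableSet_singleton v)
    simp only [Finset.coe_univ, Set.preimage_univ, Measure.restrict_apply_univ] at this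
    rw [← this]
    exact Finset.sum_congr rfl fun v _ =>
      Measure.restrict_apply (hf (measurableSet_singleton v))
  rw [hsum A, hsum (A ∩ _), Finset.mul_sum]
  refine Finset.sum_congr rfl fun v _ => ?_
  by_cases hv : ∃ y₀ ∈ A, f y₀ = v
  · obtain ⟨y₀, hy₀, rfl⟩ := hv
    have e₁ : f ⁻¹' {f y₀} ∩ A = {y | ∀ i < m, y i = y₀ i} := by
      ext y
      refine ⟨fun h i hi => congrFun h.1 ⟨i, hi⟩, fun h => ⟨funext fun i => h i i.2, ?_⟩⟩
      exact hA y₀ y (fun i hi => (h i hi).symm) hy₀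
    have e₂ : f ⁻¹' {f y₀} ∩ (A ∩ {y | y m = a}) =
        {y | ∀ i < m + 1, y i = Function.update y₀ m a i} := by
      rw [← Set.inter_assoc, e₁]
      ext y
      simp only [Set.mem_inter_iff, Set.mem_ofPred_eq, Nat.forall_lt_succ_right,
        Function.update_self]
      refine and_congr_left fun _ => forall₂_congr fun i hi => ?_
      rw [Function.update_of_ne hi.ne]
    rw [e₁, e₂, hP, hP, pow_succ']
  · have e₁ : f ⁻¹' {v} ∩ A = ∅ :=
      Set.eq_empty_of_forall_notMem fun y hy => hv ⟨y, hy.2, hy.1⟩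
    rw [← Set.inter_assoc, e₁]
    simp

theorem measurableSet_coord_eq {α : Type*} [MeasurableSpace α] [MeasurableSingletonClass α]
    (m : ℕ) (a : α) : MeasurableSet {y : ℕ → α | y m = a} :=
  (measurable_pi_apply (X := fun _ : ℕ => α) m) (measurableSet_singleton a)

theorem nth_eq_iff_of_infinite {p : ℕ → Prop} [DecidablePred p] (hp : (Set.ofPred p).Infinite)
    {n m : ℕ} : Nat.nth p n = m ↔ p m ∧ Nat.count p m = n := by
  constructor
  · rintro rfl
    exact ⟨Nat.nth_mem_of_infinite hp n, Nat.count_nth_of_infinite hp n⟩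
  · rintro ⟨hm, rfl⟩
    exact Nat.nth_count hm

section Selection

variable {α : Type*} {p : (ℕ → α) → ℕ → Prop}

theorem nth_eq_of_prefix (hp : ∀ m (y y' : ℕ → α), (∀ i < m, y i = y' i) → (p y m → p y' m))
    (hinf : ∀ y, (Set.ofPred (p y)).Infinite) {m j n : ℕ} (hj : j ≤ m) {y y' : ℕ → α}
    (h : ∀ i < m, y i = y' i) (hn : Nat.nth (p y) n = j) : Nat.nth (p y') n = j := by
  classical
  rw [nth_eq_iff_of_infinite (hinf _)] at hn ⊢
  refine ⟨hp j y y' (fun i hi => h i (hi.trans_le hj)) hn.1, ?_⟩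
  rw [← hn.2]
  refine le_antisymm (Nat.count_mono_left fun k hk => ?_) (Nat.count_mono_left fun k hk => ?_)
  · exact hp k y' y fun i hi => (h i (by omega)).symm
  · exact hp k y y' fun i hi => h i (by omega)

/-- The subsequence of `y` picked out by the places in `p y`. -/
noncomputable def select (p : (ℕ → α) → ℕ → Prop) (y : ℕ → α) (i : ℕ) : α :=
  y (Nat.nth (p y) i)

theorem measurable_select [Countable α] [MeasurableSpace α] [MeasurableSingletonClass α]
    (hp : ∀ m (y y' : ℕ → α), (∀ i < m, y i = y' i) → (p y m → p y' m))
    (hinf : ∀ y, (Set.ofPred (p y)).Infinite) : Measurable (select p) := by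
  refine measurable_pi_iff.2 fun i => measurable_to_countable' fun a => ?_
  have : (fun y => select p y i) ⁻¹' {a} =
      ⋃ m, {y | Nat.nth (p y) i = m} ∩ {y | y m = a} := by
    ext y; simp [select]
  rw [this]
  refine MeasurableSet.iUnion fun m => .inter ?_ ?_
  · exact measurableSet_of_prefix fun y y' h => nth_eq_of_prefix hp hinf le_rfl h
  · exact measurableSet_coord_eq m a

theorem select_prefix [Fintype α] [MeasurableSpace α] [MeasurableSingletonClass α]
    (hp : ∀ m (y y' : ℕ → α), (∀ i < m, y i = y' i) → (p y m → p y' m))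
    (hinf : ∀ y, (Set.ofPred (p y)).Infinite) {P : Measure (ℕ → α)} {c : ℝ≥0∞}
    (hP : ∀ (n : ℕ) (w : ℕ → α), P {y | ∀ i < n, y i = w i} = c ^ n)
    (n : ℕ) (w : ℕ → α) : P {y | ∀ i < n, select p y i = w i} = c ^ n := by
  induction n with
  | zero => simpa using hP 0 w
  | succ n ih =>
    let E (m : ℕ) : Set (ℕ → α) :=
      {y | ∀ i < n, select p y i = w i} ∩ {y | Nat.nth (p y) n = m}
    have hE (m : ℕ) : ∀ y y' : ℕ → α, (∀ i < m, y i = y' i) → y ∈ E m → y' ∈ E m := by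
      rintro y y' h ⟨h₁, h₂⟩
      refine ⟨fun i hi => ?_, nth_eq_of_prefix hp hinf le_rfl h h₂⟩
      have hlt : Nat.nth (p y) i < m := h₂ ▸ Nat.nth_strictMono (hinf y) hi
      rw [select, nth_eq_of_prefix hp hinf hlt.le h rfl, ← h _ hlt]
      exact h₁ i hi
    have hdisj : Pairwise (Function.onFun Disjoint E) := fun a b hab =>
      Set.disjoint_left.2 fun y ha hb => hab (ha.2.symm.trans hb.2)
    have e₁ : {y : ℕ → α | ∀ i < n, select p y i = w i} = ⋃ m, E m := by
      ext y; simp [E]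
    have e₂ : {y : ℕ → α | ∀ i < n + 1, select p y i = w i} =
        ⋃ m, E m ∩ {y | y m = w n} := by
      ext y
      simp only [E, select, Nat.forall_lt_succ_right, Set.mem_ofPred_eq, Set.mem_iUnion,
        Set.mem_inter_iff, and_assoc, exists_and_left, exists_eq_left']
    rw [e₁, measure_iUnion hdisj fun m => measurableSet_of_prefix (hE m)] at ih
    rw [e₂, measure_iUnion, pow_succ', ← ih, ← ENNReal.tsum_mul_left]
    · exact tsum_congr fun m => measure_prefix_inter hP (hE m) (w n)
    · exact fun a b hab => (hdisj hab).mono Set.inter_subset_left Set.inter_subset_left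
    · exact fun m => (measurableSet_of_prefix (hE m)).inter
        (measurableSet_coord_eq m _)

end Selection

/-- The real number with binary expansion `z`. -/
noncomputable def binReal (z : ℕ → Bool) : ℝ := ∑' k, ((z k).toNat : ℝ) * (1 / 2) ^ (k + 1)

theorem summable_binReal (z : ℕ → Bool) :
    Summable fun k => ((z k).toNat : ℝ) * (1 / 2) ^ (k + 1) := by
  refine Summable.of_nonneg_of_le (fun k => by positivity) (fun k => ?_)
    ((summable_nat_add_iff 1).2 summable_geometric_two)
  have : ((z k).toNat : ℝ) ≤ 1 := by exact_mod_cast Bool.toNat_le _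
  nlinarith [pow_pos (show (0 : ℝ) < 1 / 2 by norm_num) (k + 1)]

theorem binReal_nonneg (z : ℕ → Bool) : 0 ≤ binReal z := tsum_nonneg fun k => by positivity

theorem binReal_eq (z : ℕ → Bool) :
    binReal z = ((z 0).toNat + binReal fun k => z (k + 1)) / 2 := by
  rw [binReal, (summable_binReal z).tsum_eq_zero_add, binReal, add_div, ← tsum_div_const]
  congr 1
  · ring
  · exact tsum_congr fun k => by ring

theorem binReal_le_one (z : ℕ → Bool) : binReal z ≤ 1 := by
  have : (∑' k, (1 / 2 : ℝ) ^ (k + 1)) = 1 := by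
    have := summable_geometric_two.tsum_eq_zero_add
    rw [tsum_geometric_two] at this
    linarith
  rw [← this]
  refine (summable_binReal z).tsum_le_tsum (fun k => ?_)
    ((summable_nat_add_iff 1).2 summable_geometric_two)
  have : ((z k).toNat : ℝ) ≤ 1 := by exact_mod_cast Bool.toNat_le _
  nlinarith [pow_pos (show (0 : ℝ) < 1 / 2 by norm_num) (k + 1)]

theorem measurable_binReal : Measurable binReal :=
  Measurable.tsum fun k => by
    have : Measurable fun b : Bool => (b.toNat : ℝ) := measurable_of_countable _
    exact (this.comp (measurable_pi_apply k)).mul_const _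

section Bits

variable {P : Measure (ℕ → Bool)} [IsProbabilityMeasure P]

theorem measure_head_inter_tail
    (hP : ∀ (n : ℕ) (w : ℕ → Bool), P {y | ∀ i < n, y i = w i} = (1 / 2 : ℝ≥0∞) ^ n)
    (b : Bool) {A : Set (ℕ → Bool)} (hA : MeasurableSet A) :
    P ({z | z 0 = b} ∩ {z | (fun k => z (k + 1)) ∈ A}) = 1 / 2 * P A := by
  let S : (ℕ → Bool) → (ℕ → Bool) := fun z k => z (k + 1)
  have hS : Measurable S := by fun_prop
  let Q : Measure (ℕ → Bool) := (2 : ℝ≥0∞) • (P.restrict {z | z 0 = b}).map S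
  have hQ {B : Set (ℕ → Bool)} (hB : MeasurableSet B) :
      Q B = 2 * P ({z | z 0 = b} ∩ S ⁻¹' B) := by
    simp only [Q, Measure.smul_apply, smul_eq_mul]
    rw [Measure.map_apply hS hB, Measure.restrict_apply (hS hB), Set.inter_comm]
  have hQP (n : ℕ) (w : ℕ → Bool) : Q {y | ∀ i < n, y i = w i} = (1 / 2 : ℝ≥0∞) ^ n := by
    have hm : MeasurableSet {y : ℕ → Bool | ∀ i < n, y i = w i} :=
      measurableSet_of_prefix (m := n) fun y y' h hy i hi => (h i hi).symm.trans (hy i hi)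
    rw [hQ hm]
    have : {z : ℕ → Bool | z 0 = b} ∩ S ⁻¹' {y | ∀ i < n, y i = w i} =
        {z | ∀ i < n + 1, z i = Nat.casesOn i b w} := by
      ext z
      simp only [S, Nat.forall_lt_succ_left, Set.mem_ofPred_eq, Set.mem_inter_iff,
        Set.mem_preimage]
      rfl
    rw [this, hP, pow_succ', ← mul_assoc, one_div, ENNReal.mul_inv_cancel (by simp) (by simp),
      one_mul]
  have : IsProbabilityMeasure Q := ⟨by simpa using hQP 0 fun _ => false⟩
  have hQe : Q = P := ext_of_prefix fun n w => by rw [hQP, hP]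
  have := hQ hA
  rw [hQe] at this
  rw [this, ← mul_assoc, one_div, ENNReal.inv_mul_cancel (by simp) (by simp), one_mul]
  rfl

end Bits

/-- The digit attached to a node that sends the proportion `r` of its mass to the left child,
when only children of proportion above `1 / 3` are kept. -/
noncomputable def digit (r : ℝ) : Fin 3 := if r ≤ 1 / 3 then 1 else if 2 / 3 ≤ r then 0 else 2

theorem measurable_digit : Measurable digit :=
  Measurable.ite measurableSet_Iic measurable_const
    (Measurable.ite measurableSet_Ici measurable_const measurable_const)

section BitsLaw

variable {P : Measure (ℕ → Bool)} [IsProbabilityMeasure P]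

theorem measure_binReal_mem
    (hP : ∀ (n : ℕ) (w : ℕ → Bool), P {y | ∀ i < n, y i = w i} = (1 / 2 : ℝ≥0∞) ^ n)
    {A : Set ℝ} (hA : MeasurableSet A) :
    P.real {z | binReal z ∈ A} = 1 / 2 * P.real {z | binReal z / 2 ∈ A} +
      1 / 2 * P.real {z | (1 + binReal z) / 2 ∈ A} := by
  have h₀ : MeasurableSet {z | binReal z / 2 ∈ A} := (measurable_binReal.div_const 2) hA
  have h₁ : MeasurableSet {z | (1 + binReal z) / 2 ∈ A} :=
    ((measurable_binReal.const_add 1).div_const 2) hA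
  have e₀ : {z | binReal z ∈ A} ∩ {z | z 0 = false} =
      {z | z 0 = false} ∩ {z | (fun k => z (k + 1)) ∈ {z | binReal z / 2 ∈ A}} := by
    ext z
    simp only [Set.mem_inter_iff, Set.mem_ofPred_eq, binReal_eq z, and_comm]
    refine and_congr_right fun h => by simp [h]
  have e₁ : {z | binReal z ∈ A} \ {z | z 0 = false} =
      {z | z 0 = true} ∩ {z | (fun k => z (k + 1)) ∈ {z | (1 + binReal z) / 2 ∈ A}} := by
    ext z
    simp only [Set.mem_sdiff, Set.mem_inter_iff, Set.mem_ofPred_eq, binReal_eq z, and_comm,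
      Bool.not_eq_false]
    refine and_congr_right fun h => by simp [h]
  have h := measureReal_inter_add_sdiff (μ := P) (s := {z | binReal z ∈ A})
    (measurableSet_coord_eq 0 false)
  rw [← h, e₀, e₁]
  simp only [Measure.real, measure_head_inter_tail hP _ h₀, measure_head_inter_tail hP _ h₁,
    ENNReal.toReal_mul]
  simp

theorem measure_binReal_le_third
    (hP : ∀ (n : ℕ) (w : ℕ → Bool), P {y | ∀ i < n, y i = w i} = (1 / 2 : ℝ≥0∞) ^ n) :
    P.real {z | binReal z ≤ 1 / 3} = 1 / 3 ∧ P.real {z | binReal z ≤ 2 / 3} = 2 / 3 := by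
  have h₁ := measure_binReal_mem hP (measurableSet_Iic (a := (1 / 3 : ℝ)))
  have h₂ := measure_binReal_mem hP (measurableSet_Iic (a := (2 / 3 : ℝ)))
  simp only [Set.mem_Iic] at h₁ h₂
  have a₁ (z) : binReal z / 2 ≤ 1 / 3 ↔ binReal z ≤ 2 / 3 := by constructor <;> intro <;> linarith
  have a₂ (z) : (1 + binReal z) / 2 ≤ 1 / 3 ↔ False := by
    simp only [iff_false, not_le]; linarith [binReal_nonneg z]
  have a₃ (z) : binReal z / 2 ≤ 2 / 3 ↔ True := by
    simp only [iff_true]; linarith [binReal_le_one z]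
  have a₄ (z) : (1 + binReal z) / 2 ≤ 2 / 3 ↔ binReal z ≤ 1 / 3 := by
    constructor <;> intro <;> linarith
  simp only [a₁, a₂, a₃, a₄, Set.ofPred_true, Set.ofPred_false, measureReal_empty,
    probReal_univ] at h₁ h₂
  constructor <;> linarith

theorem measure_binReal_lt_third
    (hP : ∀ (n : ℕ) (w : ℕ → Bool), P {y | ∀ i < n, y i = w i} = (1 / 2 : ℝ≥0∞) ^ n) :
    P.real {z | binReal z < 1 / 3} = 1 / 3 ∧ P.real {z | binReal z < 2 / 3} = 2 / 3 := by
  have h₁ := measure_binReal_mem hP (measurableSet_Iio (a := (1 / 3 : ℝ)))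
  have h₂ := measure_binReal_mem hP (measurableSet_Iio (a := (2 / 3 : ℝ)))
  simp only [Set.mem_Iio] at h₁ h₂
  have a₁ (z) : binReal z / 2 < 1 / 3 ↔ binReal z < 2 / 3 := by constructor <;> intro <;> linarith
  have a₂ (z) : (1 + binReal z) / 2 < 1 / 3 ↔ False := by
    simp only [iff_false, not_lt]; linarith [binReal_nonneg z]
  have a₃ (z) : binReal z / 2 < 2 / 3 ↔ True := by
    simp only [iff_true]; linarith [binReal_le_one z]
  have a₄ (z) : (1 + binReal z) / 2 < 2 / 3 ↔ binReal z < 1 / 3 := by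
    constructor <;> intro <;> linarith
  simp only [a₁, a₂, a₃, a₄, Set.ofPred_true, Set.ofPred_false, measureReal_empty,
    probReal_univ] at h₁ h₂
  constructor <;> linarith

theorem measure_binReal_eq_third
    (hP : ∀ (n : ℕ) (w : ℕ → Bool), P {y | ∀ i < n, y i = w i} = (1 / 2 : ℝ≥0∞) ^ n) :
    P {z | binReal z = 1 / 3} = 0 ∧ P {z | binReal z = 2 / 3} = 0 := by
  have key {c : ℝ} (h : P.real {z | binReal z ≤ c} = P.real {z | binReal z < c}) :
      P {z | binReal z = c} = 0 := by
    have e : {z | binReal z = c} = {z | binReal z ≤ c} \ {z | binReal z < c} := by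
      ext z
      simp only [Set.mem_ofPred_eq, Set.mem_sdiff, not_lt]
      exact le_antisymm_iff
    have := measureReal_sdiff (μ := P) (s₁ := {z | binReal z ≤ c}) (s₂ := {z | binReal z < c})
      (fun z (hz : binReal z < c) => hz.le) (measurable_binReal measurableSet_Iio)
    rw [← e, h, sub_self] at this
    exact (measureReal_eq_zero_iff).1 this
  have h₁ := measure_binReal_le_third hP
  have h₂ := measure_binReal_lt_third hP
  exact ⟨key (h₁.1.trans h₂.1.symm), key (h₁.2.trans h₂.2.symm)⟩

theorem measure_digit_binReal
    (hP : ∀ (n : ℕ) (w : ℕ → Bool), P {y | ∀ i < n, y i = w i} = (1 / 2 : ℝ≥0∞) ^ n)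
    (a : Fin 3) : P {z | digit (binReal z) = a} = 1 / 3 := by
  have h₁ := (measure_binReal_le_third hP).1
  have h₂ := (measure_binReal_lt_third hP).2
  have m₁ : MeasurableSet {z | binReal z ≤ 1 / 3} := measurable_binReal measurableSet_Iic
  have m₂ : MeasurableSet {z | binReal z < 2 / 3} := measurable_binReal measurableSet_Iio
  suffices h : P.real {z | digit (binReal z) = a} = 1 / 3 by
    rw [← ENNReal.ofReal_toReal (measure_ne_top P _)]
    rw [Measure.real] at h
    rw [h, ENNReal.ofReal_div_of_pos (by norm_num)]
    simp
  fin_cases a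
  · have e : {z | digit (binReal z) = 0} = {z | binReal z < 2 / 3}ᶜ := by
      ext z
      simp only [Set.mem_ofPred_eq, Set.mem_compl_iff, not_lt, digit]
      split_ifs <;> simp <;> linarith
    simp only [Fin.zero_eta, e]
    rw [probReal_compl_eq_one_sub m₂, h₂]
    norm_num
  · have e : {z | digit (binReal z) = 1} = {z | binReal z ≤ 1 / 3} := by
      ext z
      simp only [Set.mem_ofPred_eq, digit]
      split_ifs <;> simp <;> linarith
    simp only [Fin.mk_one, e, h₁]
  · have e : {z | digit (binReal z) = 2} = {z | binReal z < 2 / 3} \ {z | binReal z ≤ 1 / 3} := by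
      ext z
      simp only [Set.mem_ofPred_eq, Set.mem_sdiff, digit]
      split_ifs <;> simp <;> grind
    simp only [Fin.reduceFinMk, e]
    have hsub : {z | binReal z ≤ 1 / 3} ⊆ {z | binReal z < 2 / 3} :=
      fun z (hz : binReal z ≤ 1 / 3) => show binReal z < 2 / 3 by linarith
    rw [measureReal_sdiff hsub m₁, h₁, h₂]
    norm_num

theorem map_columns
    (hP : ∀ (n : ℕ) (w : ℕ → Bool), P {y | ∀ i < n, y i = w i} = (1 / 2 : ℝ≥0∞) ^ n) :
    P.map (fun x n k => x (Nat.pair n k)) = Measure.infinitePi fun _ : ℕ => P := by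
  let ν : Measure Bool := P.map fun x => x 0
  have hν (b : Bool) : ν {b} = 1 / 2 := by
    rw [Measure.map_apply (measurable_pi_apply 0) (measurableSet_singleton b)]
    have := hP 1 fun _ => b
    simp only [Nat.lt_one_iff, forall_eq, pow_one] at this
    exact this
  have : IsProbabilityMeasure ν :=
    Measure.isProbabilityMeasure_map (measurable_pi_apply 0).aemeasurable
  have e : P = Measure.infinitePi fun _ : ℕ => ν :=
    ext_of_prefix fun n w => by rw [hP, infinitePi_prefix ν hν]
  have h₁ := Measure.map_infinitePi_infinitePi_of_inj (P := fun _ : ℕ => ν)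
    (f := fun q : ℕ × ℕ => Nat.pair q.1 q.2) Nat.pairEquiv.injective
  have h₂ := Measure.infinitePi_map_curry fun _ _ : ℕ => ν
  rw [← h₁, Measure.map_map (by fun_prop) (by fun_prop), ← e] at h₂
  exact h₂

theorem digits_prefix
    (hP : ∀ (n : ℕ) (w : ℕ → Bool), P {y | ∀ i < n, y i = w i} = (1 / 2 : ℝ≥0∞) ^ n)
    (n : ℕ) (w : ℕ → Fin 3) :
    P.map (fun x n => digit (binReal fun k => x (Nat.pair n k))) {y | ∀ i < n, y i = w i} =
      (1 / 3 : ℝ≥0∞) ^ n := by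
  have hm : Measurable fun z => digit (binReal z) := measurable_digit.comp measurable_binReal
  have hc : Measurable fun (x : ℕ → Bool) (n k : ℕ) => x (Nat.pair n k) := by fun_prop
  have hd : Measurable fun (y : ℕ → ℕ → Bool) n => digit (binReal (y n)) :=
    measurable_pi_iff.2 fun n => hm.comp (measurable_pi_apply n)
  have e : (fun (x : ℕ → Bool) n => digit (binReal fun k => x (Nat.pair n k))) =
      (fun (y : ℕ → ℕ → Bool) n => digit (binReal (y n))) ∘ fun x n k => x (Nat.pair n k) := rfl
  have : IsProbabilityMeasure (P.map fun z => digit (binReal z)) :=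
    Measure.isProbabilityMeasure_map hm.aemeasurable
  rw [e, ← Measure.map_map hd hc, map_columns hP, Measure.infinitePi_map_pi _ fun _ => hm]
  refine infinitePi_prefix _ (fun a => ?_) n w
  rw [Measure.map_apply hm (measurableSet_singleton a)]
  exact measure_digit_binReal hP a

end BitsLaw

theorem strVal_concat (σ : List Bool) (b : Bool) :
    strVal (σ ++ [b]) = 2 * strVal σ + b.toNat := by
  simp [strVal]

theorem strIdx_concat (σ : List Bool) (b : Bool) :
    strIdx (σ ++ [b]) = 2 * strIdx σ + b.toNat + 1 := by
  have := Nat.one_le_two_pow (n := σ.length)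
  simp only [strIdx, strVal_concat, List.length_append, List.length_singleton, pow_succ]
  omega

theorem strAt_strIdx (σ : List Bool) : strAt (strIdx σ) = σ := by
  induction σ using List.reverseRecOn with
  | nil => simp [strIdx, strVal, strAt]
  | append_singleton σ b ih =>
    rw [strIdx_concat, strAt]
    cases b
    · have : (2 * strIdx σ + false.toNat) / 2 = strIdx σ := by simp
      rw [this, ih]
      simp
    · have : (2 * strIdx σ + true.toNat) / 2 = strIdx σ := by
        simp only [Bool.toNat_true]; omega
      rw [this, ih]
      simp [Nat.add_mod]

theorem strIdx_strAt (n : ℕ) : strIdx (strAt n) = n := by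
  induction n using Nat.strong_induction_on with
  | _ n ih =>
    cases n with
    | zero => simp [strIdx, strVal, strAt]
    | succ n =>
      rw [strAt, strIdx_concat, ih _ (by omega)]
      rcases Nat.mod_two_eq_zero_or_one n with h | h <;> simp [h] <;> omega

/-- The tree of indices of strings with code `y`, where `y` is read along all strings:
`0` removes the right child of a string and `1` the left one. -/
def InTree (y : ℕ → Fin 3) : ℕ → Prop
  | 0 => True
  | n + 1 => InTree y (n / 2) ∧ y (n / 2) ≠ if n % 2 = 1 then 0 else 1
decreasing_by omega

theorem inTree_of_prefix (m : ℕ) (y y' : ℕ → Fin 3) (h : ∀ i < m, y i = y' i) :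
    InTree y m → InTree y' m := by
  induction m using Nat.strong_induction_on with
  | _ m ih =>
    cases m with
    | zero => simp [InTree]
    | succ m =>
      rw [InTree, InTree, ← h (m / 2) (by omega)]
      exact And.imp_left (ih _ (by omega) fun i hi => h i (by omega))

theorem infinite_inTree (y : ℕ → Fin 3) : (Set.ofPred (InTree y)).Infinite := by
  have step (n : ℕ) (hn : InTree y n) : ∃ m, InTree y m ∧ n < m := by
    by_cases h : y n = 1
    · refine ⟨2 * n + 1 + 1, ?_, by omega⟩
      rw [InTree, show (2 * n + 1) / 2 = n by omega]
      exact ⟨hn, by simp [h, Nat.add_mod]⟩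
    · refine ⟨2 * n + 1, ?_, by omega⟩
      rw [InTree, show 2 * n / 2 = n by omega]
      exact ⟨hn, by simpa using h⟩
  refine Set.infinite_of_forall_exists_gt fun a => ?_
  induction a with
  | zero => exact step 0 (by simp [InTree])
  | succ a ih =>
    obtain ⟨m, hm, ham⟩ := ih
    obtain ⟨k, hk, hmk⟩ := step m hm
    exact ⟨k, hk, by omega⟩

theorem mem_Tmeas_concat (m : Measure (ℕ → Bool)) (σ : List Bool) (b : Bool) :
    σ ++ [b] ∈ Tmeas m ↔ σ ∈ Tmeas m ∧ 1 / 3 * m (cyl σ) < m (cyl (σ ++ [b])) := by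
  simp only [Tmeas, Set.mem_ofPred_eq, List.length_append, List.length_singleton,
    Nat.forall_lt_succ_right]
  refine and_congr (forall₂_congr fun i hi => ?_) ?_
  · rw [List.take_append_of_le_length hi.le, List.take_append_of_le_length (by omega)]
  · rw [List.take_append_of_le_length le_rfl, List.take_length, List.take_of_length_le (by simp)]

theorem measure_cyl_pos {m : Measure (ℕ → Bool)} [IsProbabilityMeasure m] {σ : List Bool}
    (hσ : σ ∈ Tmeas m) : 0 < m (cyl σ) := by
  rcases List.eq_nil_or_concat' σ with rfl | ⟨τ, b, rfl⟩
  · have : cyl [] = Set.univ := by ext; simp [cyl, initSeg]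
    simp [this]
  · exact ((mem_Tmeas_concat m τ b).1 hσ).2.pos

theorem measure_cyl_concat (m : Measure (ℕ → Bool)) (σ : List Bool) :
    m (cyl σ) = m (cyl (σ ++ [false])) + m (cyl (σ ++ [true])) := by
  have h (b : Bool) : cyl (σ ++ [b]) = cyl σ ∩ {z | z σ.length = b} := by
    ext z
    simp [cyl, initSeg, List.range_succ]
  have hc : {z : ℕ → Bool | z σ.length = true} = {z | z σ.length = false}ᶜ := by
    ext; simp
  rw [h, h, hc, ← Set.sdiff_eq, measure_inter_add_sdiff _ (measurableSet_coord_eq _ _)]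

theorem theta_eq_select {μ : (ℕ → Bool) → Measure (ℕ → Bool)} {x : ℕ → Bool} {y : ℕ → Fin 3}
    (hT : ∀ σ b, σ ++ [b] ∈ Tmeas (μ x) ↔
      σ ∈ Tmeas (μ x) ∧ y (strIdx σ) ≠ if b = true then 0 else 1) :
    theta μ x = select InTree y := by
  classical
  have hmem (n : ℕ) : strAt n ∈ Tmeas (μ x) ↔ InTree y n := by
    induction n using Nat.strong_induction_on with
    | _ n ih =>
      cases n with
      | zero => simp [strAt, InTree, Tmeas]
      | succ n =>
        simp only [strAt, InTree, hT, ih (n / 2) (by omega), strIdx_strAt, decide_eq_true_eq]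
  have hcount (n : ℕ) :
      {τ : List Bool | τ ∈ Tmeas (μ x) ∧ strIdx τ < n}.ncard = Nat.count (InTree y) n := by
    have e : {τ : List Bool | τ ∈ Tmeas (μ x) ∧ strIdx τ < n} =
        strAt '' ((Finset.range n).filter (InTree y) : Finset ℕ) := by
      ext τ
      simp only [Set.mem_ofPred_eq, Set.mem_image, Finset.mem_coe, Finset.mem_filter,
        Finset.mem_range]
      constructor
      · rintro ⟨h₁, h₂⟩
        exact ⟨strIdx τ, ⟨h₂, by rwa [← hmem, strAt_strIdx]⟩, strAt_strIdx τ⟩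
      · rintro ⟨k, ⟨h₁, h₂⟩, rfl⟩
        exact ⟨(hmem k).2 h₂, by rwa [strIdx_strAt]⟩
    rw [e, Set.ncard_image_of_injective _ (Function.LeftInverse.injective strIdx_strAt),
      Set.ncard_coe_finset, Nat.count_eq_card_filter_range]
  funext i
  have hinf := infinite_inTree y
  have hex : ∃ σ : List Bool, σ ∈ Tmeas (μ x) ∧
      {τ : List Bool | τ ∈ Tmeas (μ x) ∧ strIdx τ < strIdx σ}.ncard = i :=
    ⟨strAt (Nat.nth (InTree y) i), (hmem _).2 (Nat.nth_mem_of_infinite hinf i), by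
      rw [hcount, strIdx_strAt, Nat.count_nth_of_infinite hinf]⟩
  have hspec := Classical.choose_spec hex
  have hidx : Nat.nth (InTree y) i = strIdx (Classical.choose hex) := by
    rw [nth_eq_iff_of_infinite hinf, ← hmem, strAt_strIdx, ← hcount]
    exact hspec
  rw [theta, dif_pos hex, select, hidx]
  simp only [hT, hspec.1, true_and]
  generalize y _ = a
  fin_cases a <;> simp

theorem concat_mem_Tmeas_iff {μ : (ℕ → Bool) → Measure (ℕ → Bool)}
    (hμprob : ∀ x, IsProbabilityMeasure (μ x))
    (hμ : ∀ (x : ℕ → Bool) (n : ℕ),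
      μ x (cyl (strAt n ++ [false])) = ENNReal.ofReal (rval n x) * μ x (cyl (strAt n)))
    (x : ℕ → Bool) (σ : List Bool) (b : Bool) :
    σ ++ [b] ∈ Tmeas (μ x) ↔
      σ ∈ Tmeas (μ x) ∧ digit (rval (strIdx σ) x) ≠ if b = true then 0 else 1 := by
  have := hμprob x
  rw [mem_Tmeas_concat]
  refine and_congr_right fun hσ => ?_
  have h₀ := hμ x (strIdx σ)
  rw [strAt_strIdx] at h₀
  have hr₀ : 0 ≤ rval (strIdx σ) x := binReal_nonneg fun k => x (Nat.pair (strIdx σ) k)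
  have hr₁ : rval (strIdx σ) x ≤ 1 := binReal_le_one fun k => x (Nat.pair (strIdx σ) k)
  have hadd := congrArg ENNReal.toReal (measure_cyl_concat (μ x) σ)
  rw [ENNReal.toReal_add (measure_ne_top _ _) (measure_ne_top _ _)] at hadd
  have hpos : 0 < (μ x (cyl σ)).toReal :=
    ENNReal.toReal_pos (measure_cyl_pos hσ).ne' (measure_ne_top _ _)
  have h₀' := congrArg ENNReal.toReal h₀
  rw [ENNReal.toReal_mul, ENNReal.toReal_ofReal hr₀] at h₀'
  rw [← ENNReal.toReal_lt_toReal (by finiteness) (by finiteness), ENNReal.toReal_mul]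
  have hthird : (1 / 3 : ℝ≥0∞).toReal = 1 / 3 := by simp
  rw [hthird]
  generalize rval (strIdx σ) x = r at *
  generalize (μ x (cyl σ)).toReal = c at *
  cases b
  · rw [h₀', mul_lt_mul_iff_left₀ hpos]
    simp only [digit]
    split_ifs <;> simp_all
  · have : (μ x (cyl (σ ++ [true]))).toReal = (1 - r) * c := by linarith
    rw [this, mul_lt_mul_iff_left₀ hpos]
    simp only [digit]
    split_ifs <;> simp <;> linarith

/-- Let `λ₂` (resp. `λ₃`) be the uniform product measure on `{0,1}^ω` (resp. `{0,1,2}^ω`),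
characterized by its values on cylinders, and for each `x ∈ {0,1}^ω` let `μ_x` be the Borel
probability measure on `{0,1}^ω` with `μ_x([σ_n 0]) = r_n(x)·μ_x([σ_n])` for every `n`.
Let `D = {x : for every n with σ_n ∈ T_{μ_x}, r_n(x) ∉ {1/3, 2/3}}`.  Then `λ₂(D) = 1`, for
every `x ∈ D` the tree `T_{μ_x}` has no dead ends, and the map `Θ` sending `x` to the code
of `T_{μ_x}` pushes `λ₂` forward to `λ₃`. -/
theorem support_coding_pushforward
    (μ2 : Measure (ℕ → Bool)) (μ3 : Measure (ℕ → Fin 3))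
    [IsProbabilityMeasure μ2] [IsProbabilityMeasure μ3]
    (h2 : ∀ (n : ℕ) (w : ℕ → Bool), μ2 {y | ∀ i < n, y i = w i} = (1 / 2 : ℝ≥0∞) ^ n)
    (h3 : ∀ (n : ℕ) (w : ℕ → Fin 3), μ3 {x | ∀ i < n, x i = w i} = (1 / 3 : ℝ≥0∞) ^ n)
    (μ : (ℕ → Bool) → Measure (ℕ → Bool))
    (hμprob : ∀ x, IsProbabilityMeasure (μ x))
    (hμ : ∀ (x : ℕ → Bool) (n : ℕ),
      μ x (cyl (strAt n ++ [false])) = ENNReal.ofReal (rval n x) * μ x (cyl (strAt n))) :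
    μ2 {x | ∀ n, strAt n ∈ Tmeas (μ x) → rval n x ≠ 1 / 3 ∧ rval n x ≠ 2 / 3} = 1 ∧
      (∀ x ∈ {x | ∀ n, strAt n ∈ Tmeas (μ x) → rval n x ≠ 1 / 3 ∧ rval n x ≠ 2 / 3},
        ∀ σ ∈ Tmeas (μ x), ∃ b, σ ++ [b] ∈ Tmeas (μ x)) ∧
      Measure.map (theta μ) μ2 = μ3 := by
  have hT := concat_mem_Tmeas_iff hμprob hμ
  let d : (ℕ → Bool) → ℕ → Fin 3 := fun x n => digit (rval n x)
  have hm (n : ℕ) : Measurable fun (x : ℕ → Bool) k => x (Nat.pair n k) :=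
    measurable_pi_iff.2 fun k => measurable_pi_apply (Nat.pair n k)
  have hcol (n : ℕ) : μ2.map (fun x k => x (Nat.pair n k)) = μ2 := by
    have e : (fun (x : ℕ → Bool) k => x (Nat.pair n k)) =
        (fun y : ℕ → ℕ → Bool => y n) ∘ fun x n k => x (Nat.pair n k) := rfl
    rw [e, ← Measure.map_map (by fun_prop) (by fun_prop), map_columns h2,
      Measure.infinitePi_map_eval]
  have hd : Measurable d := measurable_pi_iff.2 fun n =>
    measurable_digit.comp (measurable_binReal.comp (hm n))
  refine ⟨?_, fun x _ σ hσ => ?_, ?_⟩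
  · have hnull (n : ℕ) {c : ℝ} (hc : μ2 {z | binReal z = c} = 0) :
        ∀ᵐ x ∂μ2, rval n x ≠ c := by
      have hs : MeasurableSet {z | binReal z = c} :=
        measurable_binReal (measurableSet_singleton c)
      rw [← hcol n, Measure.map_apply (hm n) hs] at hc
      rw [ae_iff]
      exact measure_mono_null (fun x hx => not_not.1 hx) hc
    have hae : ∀ᵐ x ∂μ2, ∀ n, strAt n ∈ Tmeas (μ x) → rval n x ≠ 1 / 3 ∧ rval n x ≠ 2 / 3 := by
      refine ae_all_iff.2 fun n => ?_
      filter_upwards [hnull n (measure_binReal_eq_third h2).1,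
        hnull n (measure_binReal_eq_third h2).2] with x hx₁ hx₂ _ using ⟨hx₁, hx₂⟩
    rw [measure_eq_measure_of_null_sdiff (Set.subset_univ _)
      (by rwa [← Set.compl_eq_univ_sdiff]), measure_univ]
  · by_cases h : digit (rval (strIdx σ) x) = 1
    · exact ⟨true, (hT x σ true).2 ⟨hσ, by simp [h]⟩⟩
    · exact ⟨false, (hT x σ false).2 ⟨hσ, by simpa using h⟩⟩
  · have htheta : theta μ = select InTree ∘ d := funext fun x => theta_eq_select (hT x)
    have hsel : Measurable (select InTree) := measurable_select inTree_of_prefix infinite_inTree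
    rw [htheta, ← Measure.map_map hsel hd]
    have : IsProbabilityMeasure (μ2.map d) := Measure.isProbabilityMeasure_map hd.aemeasurable
    have : IsProbabilityMeasure ((μ2.map d).map (select InTree)) :=
      Measure.isProbabilityMeasure_map hsel.aemeasurable
    refine ext_of_prefix fun n w => ?_
    have hs : MeasurableSet {y : ℕ → Fin 3 | ∀ i < n, y i = w i} :=
      measurableSet_of_prefix (m := n) fun y y' h hy i hi => (h i hi).symm.trans (hy i hi)
    rw [Measure.map_apply hsel hs, h3]
    exact select_prefix inTree_of_prefix infinite_inTree (digits_prefix h2) n w
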